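/- arXiv:1503.02735 — 2 statements merged into one kernel-verified Lean document; each statement's English description precedes it below -/
import Mathlib

section
/- (Performance gap of greedy online placement.) Let H : ℝ^{M×L} → ℝ be convex and differentiable with gradient ∇H. Let x, x* ∈ ℝ^{M×L} with x ≥ 0 and x* ≥ 0 componentwise, and suppose Σ_{λ=1}^{L} x*_{iλ} = 1 for every i = 1,…,M. Let φ > 0 and ψ > 0 be constants and v₁, …, v_M real numbers such that: (i) v_i ≤ φ·(∂H/∂x_{iλ})(x) for every i and every λ; (ii) ∇H(x)·x ≤ ψ·H(x); and (iii) H(x) ≤ Σ_{i=1}^{M} v_i. Then H(x) ≤ H(φψ·x*). -/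
/-- Performance gap of greedy online placement: Let `H : ℝ^{M×L} → ℝ` be
convex and differentiable with gradient `G`. Let `x, x* ≥ 0` with `Σ_λ x*_{iλ} = 1` for
each `i`. If `φ, ψ > 0` and `v` satisfy (i) `v i ≤ φ·∂H/∂x_{iλ}(x)` for all `i, λ`,
(ii) `∇H(x)·x ≤ ψ·H(x)`, and (iii) `H(x) ≤ Σ_i v i`, then `H(x) ≤ H(φψ·x*)`. -/
theorem stmt_10 (M L : ℕ) (H : (Fin M → Fin L → ℝ) → ℝ)
    (G : (Fin M → Fin L → ℝ) → (Fin M → Fin L → ℝ))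
    (hconv : ConvexOn ℝ Set.univ H)
    (hderiv : ∀ x : Fin M → Fin L → ℝ, HasFDerivAt H
      (∑ i, ∑ lam, G x i lam •
        ((ContinuousLinearMap.proj lam : (Fin L → ℝ) →L[ℝ] ℝ).comp
          (ContinuousLinearMap.proj i : (Fin M → Fin L → ℝ) →L[ℝ] (Fin L → ℝ)))) x)
    (x xstar : Fin M → Fin L → ℝ)
    (hx : ∀ i lam, 0 ≤ x i lam) (hxstar : ∀ i lam, 0 ≤ xstar i lam)
    (hsum : ∀ i, ∑ lam, xstar i lam = 1)
    (φ ψ : ℝ) (hφ : 0 < φ) (hψ : 0 < ψ) (v : Fin M → ℝ)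
    (h1 : ∀ i lam, v i ≤ φ * G x i lam)
    (h2 : ∑ i, ∑ lam, G x i lam * x i lam ≤ ψ * H x)
    (h3 : H x ≤ ∑ i, v i) :
    H x ≤ H ((φ * ψ) • xstar) := by
  have key : ∑ i, ∑ lam, G x i lam * x i lam ≤
      ∑ i, ∑ lam, G x i lam * ((φ * ψ) • xstar) i lam := by
    have h4 : ∑ i, v i ≤ ∑ i, ∑ lam, φ * G x i lam * xstar i lam := by
      refine Finset.sum_le_sum fun i _ => ?_
      calc v i = ∑ lam, v i * xstar i lam := by rw [← Finset.mul_sum, hsum, mul_one]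
        _ ≤ _ := Finset.sum_le_sum fun l _ =>
          mul_le_mul_of_nonneg_right (h1 i l) (hxstar i l)
    calc _ ≤ ψ * H x := h2
      _ ≤ ψ * ∑ i, ∑ lam, φ * G x i lam * xstar i lam :=
        mul_le_mul_of_nonneg_left (h3.trans h4) hψ.le
      _ = _ := by
        simp only [Finset.mul_sum, Pi.smul_apply, smul_eq_mul]
        refine Finset.sum_congr rfl fun i _ => Finset.sum_congr rfl fun l _ => ?_
        ring
  generalize (φ * ψ) • xstar = y at key ⊢
  have hl : HasDerivAt (fun t : ℝ => AffineMap.lineMap (k := ℝ) x y t) (y - x) (0 : ℝ) :=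
    AffineMap.hasDerivAt_lineMap
  have hd := HasFDerivAt.comp_hasDerivAt_of_eq (0 : ℝ) (hderiv x) hl (by simp)
  have hc : ConvexOn ℝ Set.univ (H ∘ (AffineMap.lineMap (k := ℝ) x y)) := by
    simpa using hconv.comp_affineMap (AffineMap.lineMap (k := ℝ) x y)
  have := hc.le_slope_of_hasDerivAt (Set.mem_univ 0) (Set.mem_univ 1) one_pos hd
  simp [slope_def_field, mul_sub, Finset.sum_sub_distrib] at this
  linarith
end

section
/- (Optimal look-ahead window size, Proposition 4 of the paper.) Let c > 0 and σ > 0 be real constants and let G : ℝ → ℝ be a convex, nondecreasing, differentiable, nonnegative function on [1, ∞). Define θ(T) = (c·G(T) + σ)/T and Φ(T) = c·T·G′(T) − c·G(T) − σ for T ≥ 1. Suppose T₀ ≥ 1 is a real number with Φ(T₀) = 0. Then θ is nonincreasing on [1, T₀] and nondecreasing on [T₀, ∞); consequently, for every integer n ≥ 1, min( θ(⌊T₀⌋), θ(⌈T₀⌉) ) ≤ θ(n), where ⌊T₀⌋ and ⌈T₀⌉ denote the floor and ceiling of T₀ (taking ⌊T₀⌋ = 1 if T₀ < 1 is excluded by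 T₀ ≥ 1). -/
/-- Optimal look-ahead window size, Proposition 4: With `c > 0`, `σ > 0`,
`G` convex, nondecreasing, differentiable (derivative `G'`), nonnegative on `[1, ∞)`,
`θ(T) = (c·G(T) + σ)/T` and `Φ(T) = c·T·G′(T) − c·G(T) − σ`, if `T₀ ≥ 1` solves
`Φ(T₀) = 0`, then `θ` is nonincreasing on `[1, T₀]` and nondecreasing on `[T₀, ∞)`;
consequently `min(θ(⌊T₀⌋), θ(⌈T₀⌉)) ≤ θ(n)` for every integer `n ≥ 1`. -/
theorem stmt_18 (c σ : ℝ) (hc : 0 < c) (hσ : 0 < σ)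
    (G G' : ℝ → ℝ)
    (hconv : ConvexOn ℝ (Set.Ici (1 : ℝ)) G)
    (hmono : MonotoneOn G (Set.Ici (1 : ℝ)))
    (hderiv : ∀ T : ℝ, 1 ≤ T → HasDerivAt G (G' T) T)
    (hnonneg : ∀ T : ℝ, 1 ≤ T → 0 ≤ G T)
    (θ : ℝ → ℝ) (hθ : ∀ T : ℝ, θ T = (c * G T + σ) / T)
    (T₀ : ℝ) (hT₀ : 1 ≤ T₀)
    (hΦ : c * T₀ * G' T₀ - c * G T₀ - σ = 0) :
    AntitoneOn θ (Set.Icc 1 T₀) ∧ MonotoneOn θ (Set.Ici T₀) ∧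
      ∀ n : ℕ, 1 ≤ n → min (θ (⌊T₀⌋₊ : ℝ)) (θ (⌈T₀⌉₊ : ℝ)) ≤ θ (n : ℝ) := by
  have tan : ∀ x y : ℝ, 1 ≤ x → 1 ≤ y → G x + G' x * (y - x) ≤ G y := by
    intro x y hx hy
    rcases lt_trichotomy x y with h | h | h
    · have h1 := hconv.le_slope_of_hasDerivAt (x := x) (y := y) hx hy h (hderiv x hx)
      rw [slope_def_field, le_div_iff₀ (by linarith)] at h1
      linarith
    · subst h; simp
    · have h1 := hconv.slope_le_of_hasDerivAt (x := y) (y := x) hy hx h (hderiv x hx)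
      rw [slope_def_field, div_le_iff₀ (by linarith)] at h1
      linarith
  have dmono : ∀ x y : ℝ, 1 ≤ x → x ≤ y → G' x ≤ G' y := by
    intro x y hx hxy
    rcases hxy.eq_or_lt with h | h
    · rw [h]
    · have h1 := tan x y hx (hx.trans hxy)
      have h2 := tan y x (hx.trans hxy) hx
      by_contra hlt
      push Not at hlt
      nlinarith [mul_pos (sub_pos.2 h) (sub_pos.2 hlt)]
  have hA : AntitoneOn θ (Set.Icc 1 T₀) := by
    rintro s ⟨hs, hs'⟩ t ⟨ht, ht'⟩ hst
    rw [hθ, hθ, div_le_div_iff₀ (by linarith) (by linarith)]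
    have h1 := tan T₀ t hT₀ ht
    have h2 := mul_le_mul_of_nonneg_left (dmono t T₀ ht ht') (by linarith : 0 ≤ t)
    have h3 : t * G' t - G t ≤ T₀ * G' T₀ - G T₀ := by linarith
    have h4 := mul_le_mul_of_nonneg_left h3 hc.le
    have h5 : 0 ≤ c * G t + σ - c * (t * G' t) := by linarith
    have h6 := mul_nonneg (sub_nonneg.2 hst) h5
    have h7 := mul_le_mul_of_nonneg_left (tan t s ht hs) (by positivity : 0 ≤ t * c)
    linarith
  have hM : MonotoneOn θ (Set.Ici T₀) := by
    intro s hs t ht hst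
    simp only [Set.mem_Ici] at hs ht
    rw [hθ, hθ, div_le_div_iff₀ (by linarith) (by linarith)]
    have hs1 := hT₀.trans hs
    have h1 := tan s T₀ hs1 hT₀
    have h2 := mul_le_mul_of_nonneg_left (dmono T₀ s hT₀ hs) (by linarith : 0 ≤ T₀)
    have h3 : T₀ * G' T₀ - G T₀ ≤ s * G' s - G s := by linarith
    have h4 := mul_le_mul_of_nonneg_left h3 hc.le
    have h5 : 0 ≤ c * (s * G' s) - c * G s - σ := by linarith
    have h6 := mul_nonneg (sub_nonneg.2 hst) h5
    have h7 := mul_le_mul_of_nonneg_left (tan s t hs1 (hT₀.trans ht)) (by positivity : 0 ≤ s * c)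
    linarith
  refine ⟨hA, hM, fun n hn => ?_⟩
  have hn1 : (1 : ℝ) ≤ n := by exact_mod_cast hn
  rcases le_total (n : ℝ) T₀ with h | h
  · have hf : n ≤ ⌊T₀⌋₊ := Nat.le_floor h
    have hf' : (n : ℝ) ≤ (⌊T₀⌋₊ : ℝ) := by exact_mod_cast hf
    exact (min_le_left _ _).trans
      (hA ⟨hn1, h⟩ ⟨hn1.trans hf', Nat.floor_le (by linarith)⟩ hf')
  · have hf : ⌈T₀⌉₊ ≤ n := Nat.ceil_le.2 h
    have hf' : (⌈T₀⌉₊ : ℝ) ≤ (n : ℝ) := by exact_mod_cast hf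
    exact (min_le_right _ _).trans (hM (Nat.le_ceil T₀) h hf')
end
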